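/- arXiv:1811.01350 — 3 statements merged into one kernel-verified Lean document; each statement's English description precedes it below -/
import Mathlib

section
/- Let n ∈ ℤ^d and λ ∈ ℂ with Re λ > 0, and define f(w) := −|n|²/(λ + i n·w)² ∈ ℂ and g(w) := −i n/(λ + i n·w) ∈ ℂ^d for w ∈ ℝ^d. Assume the Penrose instability condition P_n( ∫ [ Φ(w)·f(w) + Σ_{j=1}^d g_j(w)·∂_jΦ(w) ] dμ(w) ) = 1 holds (this is equivalent to Λ_n(λ) = i). Define, for t ∈ ℝ, x ∈ ℝ^d and w ∈ ℝ^d, the functions r(t,x,w) := f(w)·e^{λt}e^{i n·x}, u(t,x,w) := g(w)·e^{λt}e^{i n·x} ∈ ℂ^d, and V(t,x) := e^{λt}e^{i n·x}. Then (r, u) is an exponential growing mode of the linearized multiphasic system: for every w ∈ ℝ^d and every (t,x), (i) ∂ₜ r + w·∇ₓ r + divₓ u = 0; (ii) ∂ₜ u + (w·∇ₓ) u = −∇ₓ V; and (iii) P_n( ∫ [ Φ(w')·r(t,x,w') + Σ_{j=1}^d u_j(t,x,w')·∂_jΦ(w') ] dμ(w') ) = V(t,x). -/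
open MeasureTheory Complex

noncomputable section

/-- Euclidean norm of an integer vector `n ∈ ℤ^d ⊂ ℝ^d`. -/
def znorm {d : ℕ} (n : Fin d → ℤ) : ℝ := Real.sqrt (∑ j, ((n j : ℝ)) ^ 2)

/-- Scalar product `n·w` of `n ∈ ℤ^d` with `w ∈ ℝ^d`. -/
def zdot {d : ℕ} (n : Fin d → ℤ) (w : Fin d → ℝ) : ℝ := ∑ j, (n j : ℝ) * w j

theorem zdot_update {d : ℕ} (n : Fin d → ℤ) (x : Fin d → ℝ) (j : Fin d) (y : ℝ) :
    zdot n (Function.update x j y) = zdot n x + n j * (y - x j) := by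
  have h : ∀ i, (n i : ℝ) * Function.update x j y i
      = n i * x i + if i = j then (n j : ℝ) * (y - x j) else 0 := by
    intro i
    by_cases hi : i = j
    · subst hi
      simp
      ring
    · simp [hi]
  simp [zdot, h, Finset.sum_add_distrib]

/-- Partial derivative of the plane wave `e^{i n·x}` times a constant. -/
theorem deriv_planeWave_update {d : ℕ} (n : Fin d → ℤ) (x : Fin d → ℝ) (j : Fin d) (c : ℂ) :
    deriv (fun y : ℝ => c * Complex.exp (Complex.I * (zdot n (Function.update x j y) : ℂ))) (x j)
      = Complex.I * n j * (c * Complex.exp (Complex.I * (zdot n x : ℂ))) := by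
  have h1 : HasDerivAt (fun y : ℝ => zdot n x + n j * (y - x j)) (n j : ℝ) (x j) := by
    simpa using (((hasDerivAt_id (x j)).sub_const (x j)).const_mul (n j : ℝ)).const_add (zdot n x)
  have h2 := ((h1.ofReal_comp.const_mul Complex.I).cexp).const_mul c
  simp only [zdot_update]
  rw [h2.deriv]
  simp
  ring

/-- Time derivative of `c e^{λt} e`. -/
theorem deriv_const_mul_exp_mul (lam c e : ℂ) (t : ℝ) :
    deriv (fun s : ℝ => c * Complex.exp (lam * s) * e) t = lam * (c * Complex.exp (lam * t) * e) := by
  have h1 : HasDerivAt (fun s : ℝ => lam * (s : ℂ)) (lam * 1) t :=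
    (Complex.ofRealCLM.hasDerivAt (x := t)).const_mul lam
  rw [((h1.cexp.const_mul c).mul_const e).deriv]
  ring

theorem add_I_mul_ofReal_ne_zero {lam : ℂ} (hlam : 0 < lam.re) (a : ℝ) :
    lam + Complex.I * (a : ℂ) ≠ 0 := by
  intro h
  have := congrArg Complex.re h
  simp at this
  exact hlam.ne' this

/-- The transport operator `w·∇ₓ` acts on plane waves as multiplication by `i n·w`. -/
theorem sum_mul_I_mul {d : ℕ} (n : Fin d → ℤ) (w : Fin d → ℝ) (A : ℂ) :
    ∑ j, (w j : ℂ) * (Complex.I * n j * A) = Complex.I * (zdot n w : ℂ) * A := by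
  simp only [zdot, Complex.ofReal_sum, Finset.mul_sum, Finset.sum_mul]
  refine Finset.sum_congr rfl fun j _ => ?_
  push_cast
  ring

/-- If the Penrose instability condition
`P_n(∫ [Φ(w) f(w) + Σ_j g_j(w) ∂_jΦ(w)] dμ(w)) = 1` holds with
`f(w) = -|n|²/(λ+i n·w)²` and `g(w) = -i n/(λ+i n·w)`, then
`r = f(w) e^{λt} e^{i n·x}`, `u = g(w) e^{λt} e^{i n·x}` is an exponential
growing mode of the linearized multiphasic system with potential
`V = e^{λt} e^{i n·x}`. -/
theorem stmt_6 (d m : ℕ) (hd : 1 ≤ d) (hm : 1 ≤ m) (M : ℝ) (hM : 0 < M)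
    (μ : Measure (Fin d → ℝ)) [IsProbabilityMeasure μ]
    (Φ : (Fin d → ℝ) → (Fin m → ℂ)) (hΦdiff : Differentiable ℝ Φ)
    (hΦint : Integrable Φ μ) (hΦM : ∫ w, ‖Φ w‖ ∂μ ≤ M)
    (hDΦint : Integrable (fun w => fderiv ℝ Φ w) μ)
    (hDΦM : ∫ w, ‖fderiv ℝ Φ w‖ ∂μ ≤ M)
    (P : (Fin d → ℤ) → ((Fin m → ℂ) →L[ℂ] ℂ)) (hP : ∀ n, ‖P n‖ ≤ M)
    (n : Fin d → ℤ) (lam : ℂ) (hlam : 0 < lam.re)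
    (f : (Fin d → ℝ) → ℂ) (g : (Fin d → ℝ) → (Fin d → ℂ))
    (hf : ∀ w, f w = -(((∑ j, ((n j : ℝ)) ^ 2 : ℝ)) : ℂ) / (lam + Complex.I * (zdot n w : ℂ)) ^ 2)
    (hg : ∀ w j, g w j = -Complex.I * (n j : ℂ) / (lam + Complex.I * (zdot n w : ℂ)))
    (hPenrose : P n (∫ w, f w • Φ w
        + ∑ j, g w j • fderiv ℝ Φ w (Pi.single j 1) ∂μ) = 1)
    (r : ℝ → (Fin d → ℝ) → (Fin d → ℝ) → ℂ)
    (u : ℝ → (Fin d → ℝ) → (Fin d → ℝ) → (Fin d → ℂ))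
    (V : ℝ → (Fin d → ℝ) → ℂ)
    (hr : ∀ t x w, r t x w
      = f w * Complex.exp (lam * t) * Complex.exp (Complex.I * (zdot n x : ℂ)))
    (hu : ∀ t x w j, u t x w j
      = g w j * Complex.exp (lam * t) * Complex.exp (Complex.I * (zdot n x : ℂ)))
    (hV : ∀ t x, V t x = Complex.exp (lam * t) * Complex.exp (Complex.I * (zdot n x : ℂ))) :
    -- (i) continuity equation: ∂ₜ r + w·∇ₓ r + divₓ u = 0
    (∀ (w : Fin d → ℝ) (t : ℝ) (x : Fin d → ℝ),
      deriv (fun s => r s x w) t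
        + (∑ j, (w j : ℂ) * deriv (fun y => r t (Function.update x j y) w) (x j))
        + (∑ j, deriv (fun y => u t (Function.update x j y) w j) (x j)) = 0)
    -- (ii) momentum equation: ∂ₜ u + (w·∇ₓ) u = -∇ₓ V
    ∧ (∀ (w : Fin d → ℝ) (t : ℝ) (x : Fin d → ℝ) (j : Fin d),
      deriv (fun s => u s x w j) t
        + (∑ j', (w j' : ℂ) * deriv (fun y => u t (Function.update x j' y) w j) (x j'))
        = -deriv (fun y => V t (Function.update x j y)) (x j))
    -- (iii) the potential is the macroscopic observable
    ∧ (∀ (t : ℝ) (x : Fin d → ℝ),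
      P n (∫ w', r t x w' • Φ w'
        + ∑ j, u t x w' j • fderiv ℝ Φ w' (Pi.single j 1) ∂μ) = V t x) := by
  refine ⟨fun w t x => ?_, fun w t x j => ?_, fun t x => ?_⟩
  · have hne := add_I_mul_ofReal_ne_zero hlam (zdot n w)
    simp only [hr, hu, deriv_const_mul_exp_mul, deriv_planeWave_update, sum_mul_I_mul]
    set E := Complex.exp (lam * t) * Complex.exp (Complex.I * (zdot n x : ℂ)) with hE
    have hdiv : ∑ j, Complex.I * (n j : ℂ) *
        (g w j * Complex.exp (lam * t) * Complex.exp (Complex.I * (zdot n x : ℂ)))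
        = ((∑ j, ((n j : ℝ)) ^ 2 : ℝ) : ℂ) / (lam + Complex.I * (zdot n w : ℂ)) * E := by
      rw [Complex.ofReal_sum, Finset.sum_div, Finset.sum_mul]
      refine Finset.sum_congr rfl fun j _ => ?_
      rw [hg, hE]
      push_cast
      linear_combination (-(n j : ℂ) ^ 2 / (lam + Complex.I * (zdot n w : ℂ)) *
        (Complex.exp (lam * t) * Complex.exp (Complex.I * (zdot n x : ℂ)))) * Complex.I_sq
    have htrans : (lam + Complex.I * (zdot n w : ℂ)) * f w
        = -(((∑ j, ((n j : ℝ)) ^ 2 : ℝ) : ℂ) / (lam + Complex.I * (zdot n w : ℂ))) := by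
      rw [hf]
      field_simp
    rw [hdiv]
    linear_combination E * htrans
  · have hne := add_I_mul_ofReal_ne_zero hlam (zdot n w)
    simp only [hu, hV, deriv_const_mul_exp_mul, deriv_planeWave_update, sum_mul_I_mul]
    have htrans : (lam + Complex.I * (zdot n w : ℂ)) * g w j = -(Complex.I * n j) := by
      rw [hg]
      field_simp
    linear_combination
      (Complex.exp (lam * t) * Complex.exp (Complex.I * (zdot n x : ℂ))) * htrans
  · have hint : ∀ w', r t x w' • Φ w' + ∑ j, u t x w' j • fderiv ℝ Φ w' (Pi.single j 1)
        = V t x • (f w' • Φ w' + ∑ j, g w' j • fderiv ℝ Φ w' (Pi.single j 1)) := by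
      intro w'
      simp only [hr, hu, hV, smul_add, Finset.smul_sum, smul_smul]
      congr 1
      · congr 1
        ring
      · refine Finset.sum_congr rfl fun j _ => ?_
        congr 1
        ring
    simp only [hint]
    rw [integral_smul, map_smul, hPenrose, smul_eq_mul, mul_one]
end
end

section
/- Let μ be a Borel probability measure on ℝ^d, n ∈ ℤ^d with n ≠ 0, r > 0 and φ ∈ ℝ, and set λ := |n|(r + iφ) and u := n/|n|. Assume the Penrose instability condition for Vlasov–Poisson ∫ dμ(w)/(λ + i n·w)² = −1 holds. Let c ∈ ℝ and set θ(w) := arctan((φ + u·w)/r). Define, for (t,x,w) ∈ ℝ × ℝ^d × ℝ^d: r_c(t,x,w) := −c·cos(n·x + |n|φ t − 2θ(w))·e^{|n| r t}/(r² + (φ + u·w)²), u_c(t,x,w) := c·sin(n·x + |n|φ t − θ(w))·e^{|n| r t}/√(r² + (φ + u·w)²) · u ∈ ℝ^d, and V(t,x) := c·cos(n·x + |n|φ t)·e^{|n| r t}. Then for every w ∈ ℝ^d and every (t,x): (i) ∂ₜ r_c + w·∇ₓ r_c + divₓ u_c = 0; (ii) ∂ₜ u_c + (w·∇ₓ) u_c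 = −∇ₓ V; and (iii) −Δₓ V(t,x) = ∫ r_c(t,x,w) dμ(w). In other words, (r_c, u_c, V) is a real exponential growing mode of the linearized multiphasic Vlasov–Poisson system. -/
open MeasureTheory Complex

noncomputable section

theorem znorm_pos {d : ℕ} {n : Fin d → ℤ} (hn : n ≠ 0) : 0 < znorm n := by
  obtain ⟨j, hj⟩ := Function.ne_iff.mp hn
  have hj' : (n j : ℝ) ≠ 0 := by exact_mod_cast hj
  exact Real.sqrt_pos.mpr
    (Finset.sum_pos' (fun i _ => sq_nonneg _) ⟨j, Finset.mem_univ j, by positivity⟩)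

theorem znorm_sq {d : ℕ} (n : Fin d → ℤ) : znorm n ^ 2 = ∑ j, (n j : ℝ) ^ 2 :=
  Real.sq_sqrt (Finset.sum_nonneg fun _ _ => sq_nonneg _)

theorem hasDerivAt_zdot_update {d : ℕ} (n : Fin d → ℤ) (x : Fin d → ℝ) (j : Fin d) (y : ℝ) :
    HasDerivAt (fun y => zdot n (Function.update x j y)) (n j) y := by
  simp only [zdot_update]
  simpa using (((hasDerivAt_id y).sub_const (x j)).const_mul (n j : ℝ)).const_add (zdot n x)

/-- Polar form of `r + i A` in the right half-plane. -/
theorem sqrt_mul_cos_arctan_div {r : ℝ} (hr : 0 < r) (A : ℝ) :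
    √(r ^ 2 + A ^ 2) * Real.cos (Real.arctan (A / r)) = r := by
  have h : √(r ^ 2 + A ^ 2) = r * √(1 + (A / r) ^ 2) := by
    rw [← Real.sqrt_sq hr.le, ← Real.sqrt_mul (sq_nonneg _), Real.sqrt_sq hr.le]
    congr 1
    field_simp
  have h0 : 0 < √(1 + (A / r) ^ 2) := by positivity
  rw [h, Real.cos_arctan]
  field_simp

theorem sqrt_mul_sin_arctan_div {r : ℝ} (hr : 0 < r) (A : ℝ) :
    √(r ^ 2 + A ^ 2) * Real.sin (Real.arctan (A / r)) = A := by
  have hc := (Real.cos_arctan_pos (A / r)).ne'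
  have ht := Real.tan_arctan (A / r)
  rw [Real.tan_eq_sin_div_cos, div_eq_div_iff hc hr.ne'] at ht
  apply mul_right_cancel₀ hr.ne'
  rw [mul_assoc, ht]
  linear_combination A * sqrt_mul_cos_arctan_div hr A

/-- The real part of a rotated and dilated resolvent squared, in polar coordinates. -/
theorem re_mul_inv_sq_eq {N R r A θ : ℝ} (hN : 0 < N) (hR : 0 < R) (hc : R * Real.cos θ = r)
    (hs : R * Real.sin θ = A) (a ψ : ℝ) :
    (((a * N ^ 2 : ℝ) : ℂ) * Complex.exp (ψ * I) * (1 / ((N : ℂ) * (r + I * A)) ^ 2)).re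
      = a * Real.cos (ψ - 2 * θ) / R ^ 2 := by
  have hpolar : (r : ℂ) + I * A = R * Complex.exp (θ * I) := by
    rw [Complex.exp_mul_I, ← hc, ← hs]
    push_cast
    ring
  have hsplit : Complex.exp (ψ * I)
      = Complex.exp (((ψ - 2 * θ : ℝ) : ℂ) * I) * Complex.exp (θ * I) ^ 2 := by
    rw [← Complex.exp_nat_mul, ← Complex.exp_add]
    congr 1
    push_cast
    ring
  have hN' : (N : ℂ) ≠ 0 := by exact_mod_cast hN.ne'
  have hR' : (R : ℂ) ≠ 0 := by exact_mod_cast hR.ne'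
  have hE := Complex.exp_ne_zero (θ * I)
  have h : ((a * N ^ 2 : ℝ) : ℂ) * Complex.exp (ψ * I) * (1 / ((N : ℂ) * (r + I * A)) ^ 2)
      = ((a / R ^ 2 : ℝ) : ℂ) * Complex.exp (((ψ - 2 * θ : ℝ) : ℂ) * I) := by
    rw [hpolar, hsplit]
    push_cast
    field_simp
  rw [h, Complex.re_ofReal_mul, Complex.exp_ofReal_mul_I_re]
  ring

/-- Real exponential growing mode of the linearized multiphasic Vlasov–Poisson
system: if `λ = |n|(r + iφ)` satisfies the Penrose condition
`∫ dμ(w)/(λ + i n·w)² = -1`, then the explicit real functions `r_c, u_c, V`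
solve the linearized continuity and momentum equations together with the
Poisson equation `-Δₓ V = ∫ r_c dμ`. -/
theorem stmt_7 (d : ℕ) (μ : Measure (Fin d → ℝ)) [IsProbabilityMeasure μ]
    (n : Fin d → ℤ) (hn : n ≠ 0) (r φ c : ℝ) (hr : 0 < r)
    (lam : ℂ) (hlam : lam = (znorm n : ℂ) * ((r : ℂ) + Complex.I * (φ : ℂ)))
    (u : Fin d → ℝ) (hu : ∀ j, u j = (n j : ℝ) / znorm n)
    (hPenrose : ∫ w, 1 / (lam + Complex.I * (zdot n w : ℂ)) ^ 2 ∂μ = -1)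
    (θ : (Fin d → ℝ) → ℝ) (hθ : ∀ w, θ w = Real.arctan ((φ + ∑ j, u j * w j) / r))
    (rc : ℝ → (Fin d → ℝ) → (Fin d → ℝ) → ℝ)
    (hrc : ∀ t x w, rc t x w
      = -c * Real.cos (zdot n x + znorm n * φ * t - 2 * θ w) * Real.exp (znorm n * r * t)
          / (r ^ 2 + (φ + ∑ j, u j * w j) ^ 2))
    (uc : ℝ → (Fin d → ℝ) → (Fin d → ℝ) → Fin d → ℝ)
    (huc : ∀ t x w j, uc t x w j
      = c * Real.sin (zdot n x + znorm n * φ * t - θ w) * Real.exp (znorm n * r * t)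
          / Real.sqrt (r ^ 2 + (φ + ∑ j, u j * w j) ^ 2) * u j)
    (V : ℝ → (Fin d → ℝ) → ℝ)
    (hV : ∀ t x, V t x = c * Real.cos (zdot n x + znorm n * φ * t) * Real.exp (znorm n * r * t)) :
    -- (i) continuity equation: ∂ₜ r_c + w·∇ₓ r_c + divₓ u_c = 0
    (∀ (w : Fin d → ℝ) (t : ℝ) (x : Fin d → ℝ),
      deriv (fun s => rc s x w) t
        + (∑ j, w j * deriv (fun y => rc t (Function.update x j y) w) (x j))
        + (∑ j, deriv (fun y => uc t (Function.update x j y) w j) (x j)) = 0)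
    -- (ii) momentum equation: ∂ₜ u_c + (w·∇ₓ) u_c = -∇ₓ V
    ∧ (∀ (w : Fin d → ℝ) (t : ℝ) (x : Fin d → ℝ) (j : Fin d),
      deriv (fun s => uc s x w j) t
        + (∑ j', w j' * deriv (fun y => uc t (Function.update x j' y) w j) (x j'))
        = -deriv (fun y => V t (Function.update x j y)) (x j))
    -- (iii) Poisson equation: -Δₓ V = ∫ r_c dμ
    ∧ (∀ (t : ℝ) (x : Fin d → ℝ),
      -(∑ j, deriv (deriv (fun y => V t (Function.update x j y))) (x j))
        = ∫ w, rc t x w ∂μ) := by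
  have hN : 0 < znorm n := znorm_pos hn
  have hnu : ∀ j, (n j : ℝ) = znorm n * u j := fun j => by
    rw [hu]
    field_simp
  have hzd : ∀ w : Fin d → ℝ, zdot n w = znorm n * ∑ j, u j * w j := fun w => by
    simp only [zdot, hnu, Finset.mul_sum, mul_assoc]
  have huu : ∑ j, (n j : ℝ) * u j = znorm n := by
    have h : (∑ j, (n j : ℝ) * u j) * znorm n = znorm n * znorm n := by
      rw [← sq, znorm_sq, Finset.sum_mul]
      refine Finset.sum_congr rfl fun j _ => ?_
      linear_combination -(n j : ℝ) * hnu j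
    exact mul_right_cancel₀ hN.ne' h
  have hR : ∀ w : Fin d → ℝ, 0 < √(r ^ 2 + (φ + ∑ j, u j * w j) ^ 2) := fun w => by positivity
  have hR2 : ∀ w : Fin d → ℝ, √(r ^ 2 + (φ + ∑ j, u j * w j) ^ 2) ^ 2
      = r ^ 2 + (φ + ∑ j, u j * w j) ^ 2 := fun w => Real.sq_sqrt (by positivity)
  have hcos : ∀ w, √(r ^ 2 + (φ + ∑ j, u j * w j) ^ 2) * Real.cos (θ w) = r := fun w => by
    rw [hθ]
    exact sqrt_mul_cos_arctan_div hr _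
  have hsin : ∀ w, √(r ^ 2 + (φ + ∑ j, u j * w j) ^ 2) * Real.sin (θ w)
      = φ + ∑ j, u j * w j := fun w => by
    rw [hθ]
    exact sqrt_mul_sin_arctan_div hr _
  have hphase : ∀ (a x₀ t : ℝ), HasDerivAt (fun s => x₀ + znorm n * φ * s - a) (znorm n * φ) t :=
    fun a x₀ t => by
      simpa using (((hasDerivAt_id t).const_mul (znorm n * φ)).const_add x₀).sub_const a
  have hexp : ∀ t, HasDerivAt (fun s => Real.exp (znorm n * r * s))
      (Real.exp (znorm n * r * t) * (znorm n * r)) t := fun t => by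
    simpa using ((hasDerivAt_id t).const_mul (znorm n * r)).exp
  have hspace : ∀ (x : Fin d → ℝ) (j : Fin d) (a b y : ℝ),
      HasDerivAt (fun y => zdot n (Function.update x j y) + b - a) (n j) y :=
    fun x j a b y => ((hasDerivAt_zdot_update n x j y).add_const b).sub_const a
  refine ⟨fun w t x => ?_, fun w t x j => ?_, fun t x => ?_⟩
  · simp only [hrc, huc]
    have hA := hcos w
    have hB := hsin w
    rw [← hR2 w]
    have hRw := hR w
    have hsw : ∑ j, u j * w j = √(r ^ 2 + (φ + ∑ j, u j * w j) ^ 2) * Real.sin (θ w) - φ := by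
      linarith
    generalize √(r ^ 2 + (φ + ∑ j, u j * w j) ^ 2) = R at *
    have h1 := ((((hphase (2 * θ w) (zdot n x) t).cos.const_mul (-c)).fun_mul (hexp t)).div_const
      (R ^ 2)).deriv
    have h2 := fun j => ((((hspace x j (2 * θ w) (znorm n * φ * t) (x j)).cos.const_mul
      (-c)).mul_const (Real.exp (znorm n * r * t))).div_const (R ^ 2)).deriv
    have h3 := fun j => (((((hspace x j (θ w) (znorm n * φ * t) (x j)).sin.const_mul
      c).mul_const (Real.exp (znorm n * r * t))).div_const R).mul_const (u j)).deriv
    simp only [Function.update_eq_self] at h2 h3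
    rw [h1]
    simp only [Real.sqrt_sq hRw.le, h2, h3]
    set ψ := zdot n x + znorm n * φ * t
    set E := Real.exp (znorm n * r * t)
    have s2 : ∑ j, w j * (-c * (-Real.sin (ψ - 2 * θ w) * (n j : ℝ)) * E / R ^ 2)
        = c * Real.sin (ψ - 2 * θ w) * E / R ^ 2 * zdot n w := by
      rw [zdot, Finset.mul_sum]
      exact Finset.sum_congr rfl fun j _ => by ring
    have s3 : ∑ j, c * (Real.cos (ψ - θ w) * (n j : ℝ)) * E / R * u j
        = c * Real.cos (ψ - θ w) * E / R * znorm n := by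
      rw [← huu, Finset.mul_sum]
      exact Finset.sum_congr rfl fun j _ => by ring
    have hψθ : Real.cos (ψ - θ w) = Real.cos (ψ - 2 * θ w) * Real.cos (θ w)
        - Real.sin (ψ - 2 * θ w) * Real.sin (θ w) := by
      rw [← Real.cos_add]
      ring_nf
    rw [s2, s3, hzd, hsw, hψθ, ← hA]
    field_simp
    ring
  · simp only [huc, hV]
    have hA := hcos w
    have hRw := hR w
    have hsw : ∑ j, u j * w j = √(r ^ 2 + (φ + ∑ j, u j * w j) ^ 2) * Real.sin (θ w) - φ := by
      linarith [hsin w]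
    generalize √(r ^ 2 + (φ + ∑ j, u j * w j) ^ 2) = R at *
    have h1 := (((((hphase (θ w) (zdot n x) t).sin.const_mul c).fun_mul (hexp t)).div_const
      R).mul_const (u j)).deriv
    have h2 := fun j' => (((((hspace x j' (θ w) (znorm n * φ * t) (x j')).sin.const_mul
      c).mul_const (Real.exp (znorm n * r * t))).div_const R).mul_const (u j)).deriv
    have h3 := (((((hasDerivAt_zdot_update n x j (x j)).add_const (znorm n * φ * t)).cos.const_mul
      c).mul_const (Real.exp (znorm n * r * t)))).deriv
    simp only [Function.update_eq_self] at h2 h3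
    rw [h1, h3]
    simp only [h2]
    set ψ := zdot n x + znorm n * φ * t
    set E := Real.exp (znorm n * r * t)
    have s2 : ∑ j', w j' * (c * (Real.cos (ψ - θ w) * (n j' : ℝ)) * E / R * u j)
        = c * Real.cos (ψ - θ w) * E / R * u j * zdot n w := by
      rw [zdot, Finset.mul_sum]
      exact Finset.sum_congr rfl fun j' _ => by ring
    have hψθ : Real.sin ψ = Real.sin (ψ - θ w) * Real.cos (θ w)
        + Real.cos (ψ - θ w) * Real.sin (θ w) := by
      rw [← Real.sin_add]
      ring_nf
    rw [s2, hzd, hsw, hψθ, ← hA, hnu j]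
    field_simp
    ring
  · set ψ := zdot n x + znorm n * φ * t
    set E := Real.exp (znorm n * r * t)
    have hlap : ∀ j, deriv (deriv fun y => V t (Function.update x j y)) (x j)
        = -(c * Real.cos ψ * E) * (n j : ℝ) ^ 2 := fun j => by
      have hz : ∀ y, HasDerivAt (fun y => zdot n (Function.update x j y) + znorm n * φ * t)
          (n j) y := fun y => (hasDerivAt_zdot_update n x j y).add_const _
      have h1 : deriv (fun y => V t (Function.update x j y)) = fun y =>
          c * (-Real.sin (zdot n (Function.update x j y) + znorm n * φ * t) * n j) * E := by
        funext y
        simp only [hV]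
        exact (((hz y).cos.const_mul c).mul_const E).deriv
      have h2 := (((((hz (x j)).sin.fun_neg).mul_const (n j : ℝ)).const_mul c).mul_const E).deriv
      rw [h1, h2, Function.update_eq_self]
      ring
    have hint : Integrable (fun w => 1 / (lam + Complex.I * (zdot n w : ℂ)) ^ 2) μ := by
      by_contra h
      rw [integral_undef h] at hPenrose
      norm_num at hPenrose
    have hrc_re : ∀ w, rc t x w = ((((-c * E) * znorm n ^ 2 : ℝ) : ℂ) * Complex.exp (ψ * I)
        * (1 / (lam + Complex.I * (zdot n w : ℂ)) ^ 2)).re := fun w => by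
      have hden : lam + Complex.I * (zdot n w : ℂ)
          = (znorm n : ℂ) * (r + I * (φ + ∑ j, u j * w j : ℝ)) := by
        rw [hlam, hzd]
        push_cast
        ring
      rw [hden, re_mul_inv_sq_eq hN (hR w) (hcos w) (hsin w), hR2, hrc]
      ring
    have hre := Complex.reCLM.integral_comp_comm
      (hint.const_mul ((((-c * E) * znorm n ^ 2 : ℝ) : ℂ) * Complex.exp (ψ * I)))
    simp only [Complex.reCLM_apply] at hre
    simp only [hlap, hrc_re]
    rw [hre, integral_const_mul, hPenrose, ← Finset.mul_sum, ← znorm_sq, mul_neg_one,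
      Complex.neg_re, Complex.re_ofReal_mul, Complex.exp_ofReal_mul_I_re]
    ring
end
end

section
/- Let δ ≥ 0, let a ∈ ℝ^d, let k ∈ ℕ^d be a multi-index, and let f = (f_1,…,f_d) be a d-tuple of coefficient families ℤ^d → ℂ with |f|_δ < ∞. Then ‖(ã+f)^k − ã^k − Σ_{i : k_i ≥ 1} k_i · ã^{k−𝟙_i} * f_i‖_δ ≤ |f|_δ² · |k|(|k|−1) · ( |a|_∞ + |f|_δ )^{|k|−2}, where 𝟙_i denotes the i-th standard multi-index (so ã^{k−𝟙_i} is the family supported at frequency 0 with value Π_j a_j^{(k−𝟙_i)_j}). -/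
open ENNReal

noncomputable section

/-- The weighted analytic norm `‖u‖_δ = Σ_n ‖u_n‖ e^{δ|n|} ∈ [0,∞]` of a
coefficient family `u : ℤ^d → B`. -/
def anorm {d : ℕ} {B : Type*} [NormedAddCommGroup B] (δ : ℝ)
    (u : (Fin d → ℤ) → B) : ℝ≥0∞ :=
  ∑' n : Fin d → ℤ, (‖u n‖₊ : ℝ≥0∞) * ENNReal.ofReal (Real.exp (δ * znorm n))

/-- The weighted analytic norm of the derivative,
`‖Du‖_δ = Σ_n |n|·‖u_n‖ e^{δ|n|} ∈ [0,∞]`. -/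
def dnorm {d : ℕ} {B : Type*} [NormedAddCommGroup B] (δ : ℝ)
    (u : (Fin d → ℤ) → B) : ℝ≥0∞ :=
  ∑' n : Fin d → ℤ,
    ENNReal.ofReal (znorm n) * (‖u n‖₊ : ℝ≥0∞) * ENNReal.ofReal (Real.exp (δ * znorm n))

/-- The unit coefficient family: `1` at frequency `0`, `0` elsewhere. -/
def convOne (d : ℕ) : (Fin d → ℤ) → ℂ := fun n => if n = 0 then 1 else 0

/-- Convolution of two coefficient families: `(u*v)_n = Σ_{k+l=n} u_k v_l`. -/
def conv {d : ℕ} (u v : (Fin d → ℤ) → ℂ) : (Fin d → ℤ) → ℂ :=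
  fun n => ∑' k : Fin d → ℤ, u k * v (n - k)

/-- Convolution powers of a coefficient family. -/
def convPow {d : ℕ} (u : (Fin d → ℤ) → ℂ) : ℕ → (Fin d → ℤ) → ℂ
  | 0 => convOne d
  | m + 1 => conv u (convPow u m)

/-- The convolution product `Π_{i} F_i^{*k_i}` of a `d`-tuple of coefficient
families raised to the multi-index `k`. -/
def convProd {d : ℕ} (F : Fin d → (Fin d → ℤ) → ℂ) (k : Fin d → ℕ) :
    (Fin d → ℤ) → ℂ :=
  ((List.finRange d).map fun i => convPow (F i) (k i)).foldr conv (convOne d)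

/-- The coefficient family of the constant `a ∈ ℝ^d`: the `i`-th family equals
`a_i` at frequency `0` and vanishes elsewhere. -/
def constFam {d : ℕ} (a : Fin d → ℝ) : Fin d → (Fin d → ℤ) → ℂ :=
  fun i n => if n = 0 then (a i : ℂ) else 0

/-- The constant family with value `α` at frequency `0`. -/
def scalarFam (d : ℕ) (α : ℂ) : (Fin d → ℤ) → ℂ := fun n => if n = 0 then α else 0

lemma znorm_add_le {d : ℕ} (m n : Fin d → ℤ) : znorm (m + n) ≤ znorm m + znorm n := by
  have h (p : Fin d → ℤ) : znorm p = ‖WithLp.toLp 2 (fun j => (p j : ℝ))‖ := by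
    simp [znorm, EuclideanSpace.norm_eq]
  rw [h, h, h]
  refine le_trans (le_of_eq ?_) (norm_add_le _ _)
  congr 1
  ext j
  simp

lemma znorm_nonneg {d : ℕ} (n : Fin d → ℤ) : 0 ≤ znorm n := Real.sqrt_nonneg _

lemma anorm_zero {d : ℕ} (δ : ℝ) : anorm δ (0 : (Fin d → ℤ) → ℂ) = 0 := by
  simp [anorm]

lemma anorm_add_le {d : ℕ} (δ : ℝ) (u v : (Fin d → ℤ) → ℂ) :
    anorm δ (u + v) ≤ anorm δ u + anorm δ v := by
  unfold anorm
  rw [← ENNReal.tsum_add]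
  refine ENNReal.tsum_le_tsum fun n => ?_
  rw [← add_mul]
  gcongr
  exact_mod_cast nnnorm_add_le (u n) (v n)

lemma anorm_smul {d : ℕ} (δ : ℝ) (c : ℂ) (u : (Fin d → ℤ) → ℂ) :
    anorm δ (c • u) = ‖c‖₊ * anorm δ u := by
  simp [anorm, ← ENNReal.tsum_mul_left, mul_assoc]

lemma anorm_scalarFam {d : ℕ} (δ : ℝ) (α : ℂ) : anorm δ (scalarFam d α) = ‖α‖₊ := by
  unfold anorm
  rw [tsum_eq_single 0]
  · simp [scalarFam, znorm]
  · intro n hn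
    simp [scalarFam, hn]

lemma tsum_nnnorm_le_anorm {d : ℕ} {δ : ℝ} (hδ : 0 ≤ δ) (u : (Fin d → ℤ) → ℂ) :
    ∑' n, (‖u n‖₊ : ℝ≥0∞) ≤ anorm δ u := by
  refine ENNReal.tsum_le_tsum fun n => le_mul_of_one_le_right' ?_
  rw [ENNReal.one_le_ofReal]
  exact Real.one_le_exp (mul_nonneg hδ (znorm_nonneg n))

lemma summable_conv {d : ℕ} {δ : ℝ} (hδ : 0 ≤ δ) {u v : (Fin d → ℤ) → ℂ}
    (hu : anorm δ u ≠ ⊤) (hv : anorm δ v ≠ ⊤) (n : Fin d → ℤ) :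
    Summable fun k => u k * v (n - k) := by
  apply Summable.of_nnnorm
  rw [← ENNReal.tsum_coe_ne_top_iff_summable]
  refine ne_top_of_le_ne_top (ENNReal.mul_ne_top hu hv) ?_
  refine le_trans ?_ (mul_le_mul' (tsum_nnnorm_le_anorm hδ u) (tsum_nnnorm_le_anorm hδ v))
  rw [← ENNReal.tsum_mul_right]
  refine ENNReal.tsum_le_tsum fun k => ?_
  rw [nnnorm_mul, ENNReal.coe_mul]
  gcongr
  exact ENNReal.le_tsum (f := fun m => (‖v m‖₊ : ℝ≥0∞)) (n - k)

lemma anorm_conv_le {d : ℕ} {δ : ℝ} (hδ : 0 ≤ δ) (u v : (Fin d → ℤ) → ℂ) :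
    anorm δ (conv u v) ≤ anorm δ u * anorm δ v := by
  set w : (Fin d → ℤ) → ℝ≥0∞ := fun n => ENNReal.ofReal (Real.exp (δ * znorm n)) with hw
  have hw_le (k n : Fin d → ℤ) : w n ≤ w k * w (n - k) := by
    simp only [hw]
    rw [← ENNReal.ofReal_mul (Real.exp_pos _).le, ← Real.exp_add, ← mul_add]
    gcongr
    simpa using znorm_add_le k (n - k)
  calc anorm δ (conv u v)
      ≤ ∑' n, ∑' k, (‖u k‖₊ * w k) * (‖v (n - k)‖₊ * w (n - k)) := by
        refine ENNReal.tsum_le_tsum fun n => ?_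
        calc (‖conv u v n‖₊ : ℝ≥0∞) * w n
            ≤ (∑' k, (‖u k * v (n - k)‖₊ : ℝ≥0∞)) * w n := by
              gcongr
              exact enorm_tsum_le_tsum_enorm (f := fun k => u k * v (n - k))
          _ = ∑' k, (‖u k * v (n - k)‖₊ : ℝ≥0∞) * w n := ENNReal.tsum_mul_right.symm
          _ ≤ _ := by
              refine ENNReal.tsum_le_tsum fun k => ?_
              rw [nnnorm_mul, ENNReal.coe_mul, mul_mul_mul_comm]
              gcongr
              exact hw_le k n
    _ = ∑' k, ∑' n, (‖u k‖₊ * w k) * (‖v (n - k)‖₊ * w (n - k)) := ENNReal.tsum_comm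
    _ = ∑' k, (‖u k‖₊ * w k) * anorm δ v := by
        refine tsum_congr fun k => ?_
        rw [ENNReal.tsum_mul_left]
        congr 1
        exact (Equiv.subRight k).tsum_eq fun m => (‖v m‖₊ : ℝ≥0∞) * w m
    _ = anorm δ u * anorm δ v := ENNReal.tsum_mul_right

lemma conv_scalarFam_left {d : ℕ} (α : ℂ) (v : (Fin d → ℤ) → ℂ) :
    conv (scalarFam d α) v = α • v := by
  ext n
  unfold conv
  rw [tsum_eq_single 0]
  · simp [scalarFam]
  · intro k hk
    simp [scalarFam, hk]

lemma conv_scalarFam_right {d : ℕ} (u : (Fin d → ℤ) → ℂ) (α : ℂ) :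
    conv u (scalarFam d α) = α • u := by
  ext n
  unfold conv
  rw [tsum_eq_single n]
  · simp [scalarFam, mul_comm]
  · intro k hk
    simp [scalarFam, sub_eq_zero, hk.symm]

lemma conv_sub_left {d : ℕ} {δ : ℝ} (hδ : 0 ≤ δ) {u v w : (Fin d → ℤ) → ℂ}
    (hu : anorm δ u ≠ ⊤) (hv : anorm δ v ≠ ⊤) (hw : anorm δ w ≠ ⊤) :
    conv (u - v) w = conv u w - conv v w := by
  ext n
  simp only [conv, Pi.sub_apply, sub_mul]
  exact (summable_conv hδ hu hw n).tsum_sub (summable_conv hδ hv hw n)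

lemma conv_sub_right {d : ℕ} {δ : ℝ} (hδ : 0 ≤ δ) {u v w : (Fin d → ℤ) → ℂ}
    (hu : anorm δ u ≠ ⊤) (hv : anorm δ v ≠ ⊤) (hw : anorm δ w ≠ ⊤) :
    conv u (v - w) = conv u v - conv u w := by
  ext n
  simp only [conv, Pi.sub_apply, mul_sub]
  exact (summable_conv hδ hu hv n).tsum_sub (summable_conv hδ hu hw n)

lemma scalarFam_mul_eq_smul {d : ℕ} (α β : ℂ) :
    scalarFam d (α * β) = α • scalarFam d β := by
  ext n
  simp [scalarFam]

/-- Bounds on a product `P` of `m` perturbed scalars, with scalar part `α` and first-order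
part `L`, where the perturbations have size `s` and the factors have size `C`. -/
structure TaylorBound {d : ℕ} (δ : ℝ) (s C : ℝ≥0∞) (m : ℕ) (P : (Fin d → ℤ) → ℂ) (α : ℂ)
    (L : (Fin d → ℤ) → ℂ) : Prop where
  total : anorm δ P ≤ C ^ m
  scalar : (‖α‖₊ : ℝ≥0∞) ≤ C ^ m
  linear : anorm δ L ≤ m * s * C ^ (m - 1)
  increment : anorm δ (P - scalarFam d α) ≤ m * s * C ^ (m - 1)
  remainder : anorm δ (P - scalarFam d α - L) ≤
    s ^ 2 * (m : ℝ≥0∞) * ((m - 1 : ℕ) : ℝ≥0∞) * C ^ (m - 2)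

lemma first_order_bound_mul (s C : ℝ≥0∞) (m n : ℕ) :
    (m * s * C ^ (m - 1)) * C ^ n = m * s * C ^ (m + n - 1) := by
  rcases m with _ | m
  · simp
  · rw [mul_assoc, ← pow_add]
    congr 2
    omega

lemma first_order_bound_add (s C : ℝ≥0∞) (m n : ℕ) :
    (m * s * C ^ (m - 1)) * C ^ n + C ^ m * (n * s * C ^ (n - 1)) =
      ((m + n : ℕ) : ℝ≥0∞) * s * C ^ (m + n - 1) := by
  rw [mul_comm (C ^ m), first_order_bound_mul, first_order_bound_mul, add_comm n m]
  push_cast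
  ring

lemma second_order_bound_mul (s C : ℝ≥0∞) (m n : ℕ) :
    (s ^ 2 * (m : ℝ≥0∞) * ((m - 1 : ℕ) : ℝ≥0∞) * C ^ (m - 2)) * C ^ n =
      s ^ 2 * (m : ℝ≥0∞) * ((m - 1 : ℕ) : ℝ≥0∞) * C ^ (m + n - 2) := by
  rcases m with _ | _ | m
  · simp
  · simp
  · rw [mul_assoc, ← pow_add]
    congr 2
    omega

lemma first_order_bound_mul_first_order_bound (s C : ℝ≥0∞) (m n : ℕ) :
    (m * s * C ^ (m - 1)) * (n * s * C ^ (n - 1)) =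
      s ^ 2 * (m : ℝ≥0∞) * (n : ℝ≥0∞) * C ^ (m + n - 2) := by
  rcases m with _ | m
  · simp
  rcases n with _ | n
  · simp
  rw [show m + 1 + (n + 1) - 2 = m + n by omega, pow_add]
  simp only [Nat.add_sub_cancel]
  ring

lemma second_order_bound_add_le (s C : ℝ≥0∞) (m n : ℕ) :
    (s ^ 2 * (m : ℝ≥0∞) * ((m - 1 : ℕ) : ℝ≥0∞) * C ^ (m - 2)) * C ^ n
      + C ^ m * (s ^ 2 * (n : ℝ≥0∞) * ((n - 1 : ℕ) : ℝ≥0∞) * C ^ (n - 2))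
      + (m * s * C ^ (m - 1)) * (n * s * C ^ (n - 1)) ≤
      s ^ 2 * ((m + n : ℕ) : ℝ≥0∞) * ((m + n - 1 : ℕ) : ℝ≥0∞) * C ^ (m + n - 2) := by
  rw [mul_comm (C ^ m), second_order_bound_mul, second_order_bound_mul,
    first_order_bound_mul_first_order_bound, add_comm n m]
  have key : m * (m - 1) + n * (n - 1) + m * n ≤ (m + n) * (m + n - 1) := by
    rcases m with _ | m
    · simp
    rcases n with _ | n
    · simp
    rw [show m + 1 + (n + 1) - 1 = m + n + 1 by omega]
    simp only [Nat.add_sub_cancel]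
    nlinarith
  calc _ = s ^ 2 * ((m * (m - 1) + n * (n - 1) + m * n : ℕ) : ℝ≥0∞) * C ^ (m + n - 2) := by
        simp only [Nat.cast_add, Nat.cast_mul]
        ring
    _ ≤ s ^ 2 * (((m + n) * (m + n - 1) : ℕ) : ℝ≥0∞) * C ^ (m + n - 2) := by
        gcongr
    _ = _ := by
        simp only [Nat.cast_mul]
        ring

namespace TaylorBound

variable {d : ℕ} {δ : ℝ} {s C : ℝ≥0∞}

lemma one : TaylorBound δ s C 0 (convOne d) 1 0 := by
  have h : convOne d = scalarFam d 1 := rfl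
  rw [h]
  constructor <;> simp [anorm_zero, anorm_scalarFam]

lemma scalar_add {α : ℂ} {f : (Fin d → ℤ) → ℂ} (hα : ‖α‖₊ + s ≤ C) (hf : anorm δ f ≤ s) :
    TaylorBound δ s C 1 (scalarFam d α + f) α f := by
  constructor
  · rw [pow_one]
    refine (anorm_add_le _ _ _).trans (le_trans ?_ hα)
    rw [anorm_scalarFam]
    gcongr
  · simpa using le_self_add.trans hα
  · simpa using hf
  · simpa using hf
  · simp [anorm_zero]

lemma mul (hδ : 0 ≤ δ) (hs : s ≠ ⊤) (hC : C ≠ ⊤) {m n : ℕ} {P Q L M : (Fin d → ℤ) → ℂ}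
    {α β : ℂ} (hP : TaylorBound δ s C m P α L) (hQ : TaylorBound δ s C n Q β M) :
    TaylorBound δ s C (m + n) (conv P Q) (α * β) (α • M + β • L) := by
  have hP_fin : anorm δ P ≠ ⊤ := ne_top_of_le_ne_top (ENNReal.pow_ne_top hC) hP.total
  have hQ_fin : anorm δ Q ≠ ⊤ := ne_top_of_le_ne_top (ENNReal.pow_ne_top hC) hQ.total
  have hB_fin : m * s * C ^ (m - 1) ≠ ⊤ :=
    ENNReal.mul_ne_top (ENNReal.mul_ne_top (ENNReal.natCast_ne_top m) hs)
      (ENNReal.pow_ne_top hC)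
  have hL_fin : anorm δ L ≠ ⊤ := ne_top_of_le_ne_top hB_fin hP.linear
  have hI_fin : anorm δ (P - scalarFam d α) ≠ ⊤ := ne_top_of_le_ne_top hB_fin hP.increment
  have hα_fin : anorm δ (scalarFam d α) ≠ ⊤ := by simp [anorm_scalarFam]
  have hβ_fin : anorm δ (scalarFam d β) ≠ ⊤ := by simp [anorm_scalarFam]
  have h_inc : conv P Q - scalarFam d (α * β) =
      conv (P - scalarFam d α) Q + α • (Q - scalarFam d β) := by
    rw [conv_sub_left hδ hP_fin hα_fin hQ_fin, conv_scalarFam_left, scalarFam_mul_eq_smul,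
      smul_sub]
    abel
  have h_rem : conv P Q - scalarFam d (α * β) - (α • M + β • L) =
      conv (P - scalarFam d α - L) Q + α • (Q - scalarFam d β - M)
        + conv L (Q - scalarFam d β) := by
    rw [conv_sub_left hδ hI_fin hL_fin hQ_fin, conv_sub_left hδ hP_fin hα_fin hQ_fin,
      conv_sub_right hδ hL_fin hQ_fin hβ_fin, conv_scalarFam_left, conv_scalarFam_right,
      scalarFam_mul_eq_smul, smul_sub, smul_sub]
    abel
  constructor
  · rw [pow_add]
    exact (anorm_conv_le hδ P Q).trans (mul_le_mul' hP.total hQ.total)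
  · rw [pow_add, nnnorm_mul, ENNReal.coe_mul]
    exact mul_le_mul' hP.scalar hQ.scalar
  · rw [← first_order_bound_add, add_comm (α • M)]
    refine (anorm_add_le _ _ _).trans ?_
    rw [anorm_smul, anorm_smul, mul_comm (‖β‖₊ : ℝ≥0∞)]
    exact add_le_add (mul_le_mul' hP.linear hQ.scalar) (mul_le_mul' hP.scalar hQ.linear)
  · rw [h_inc, ← first_order_bound_add]
    refine (anorm_add_le _ _ _).trans ?_
    rw [anorm_smul]
    exact add_le_add ((anorm_conv_le hδ _ _).trans (mul_le_mul' hP.increment hQ.total))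
      (mul_le_mul' hP.scalar hQ.increment)
  · rw [h_rem]
    refine le_trans ?_ (second_order_bound_add_le s C m n)
    refine (anorm_add_le _ _ _).trans (add_le_add ((anorm_add_le _ _ _).trans ?_) ?_)
    · rw [anorm_smul]
      exact add_le_add ((anorm_conv_le hδ _ _).trans (mul_le_mul' hP.remainder hQ.total))
        (mul_le_mul' hP.scalar hQ.remainder)
    · exact (anorm_conv_le hδ _ _).trans (mul_le_mul' hP.linear hQ.increment)

lemma convPow (hδ : 0 ≤ δ) (hs : s ≠ ⊤) (hC : C ≠ ⊤) {α : ℂ} {u f : (Fin d → ℤ) → ℂ}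
    (hu : TaylorBound δ s C 1 u α f) (m : ℕ) :
    TaylorBound δ s C m (_root_.convPow u m) (α ^ m) ((m * α ^ (m - 1)) • f) := by
  induction m with
  | zero => simpa [_root_.convPow] using one
  | succ m ih =>
    have h := hu.mul hδ hs hC ih
    have hL : α • ((m * α ^ (m - 1)) • f) + α ^ m • f =
        (((m + 1 : ℕ) : ℂ) * α ^ (m + 1 - 1)) • f := by
      rw [smul_smul, ← add_smul]
      congr 1
      rcases m with _ | m
      · simp
      · simp only [Nat.add_sub_cancel]
        push_cast
        ring
    rw [hL, add_comm 1 m, ← pow_succ'] at h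
    exact h

lemma foldr_conv (hδ : 0 ≤ δ) (hs : s ≠ ⊤) (hC : C ≠ ⊤) {ι : Type*} [DecidableEq ι]
    {α : ι → ℂ} {u f : ι → (Fin d → ℤ) → ℂ} (hu : ∀ i, TaylorBound δ s C 1 (u i) (α i) (f i))
    (k : ι → ℕ) (l : List ι) (hl : l.Nodup) :
    TaylorBound δ s C (l.map k).sum
      ((l.map fun i => _root_.convPow (u i) (k i)).foldr conv (convOne d))
      (l.map fun i => α i ^ k i).prod
      (l.map fun i => (k i * (l.map fun j => α j ^ (k j - if j = i then 1 else 0)).prod) •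
        f i).sum := by
  induction l with
  | nil => simpa using one
  | cons i l ih =>
    obtain ⟨hi, hl⟩ := List.nodup_cons.mp hl
    have h := ((hu i).convPow hδ hs hC (k i)).mul hδ hs hC (ih hl)
    simp only [List.map_cons, List.sum_cons, List.prod_cons, List.foldr_cons]
    convert h using 1
    rw [add_comm]
    congr 1
    · rw [List.smul_sum, List.map_map]
      congr 1
      refine List.map_congr_left fun j hj => ?_
      have hij : i ≠ j := fun h => hi (h ▸ hj)
      simp only [Function.comp_apply, if_neg hij, Nat.sub_zero, smul_smul]
      congr 1
      ring
    · rw [smul_smul, if_pos trivial]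
      congr 1
      have : (l.map fun j => α j ^ (k j - if j = i then 1 else 0)) =
          l.map fun j => α j ^ k j := by
        refine List.map_congr_left fun j hj => ?_
        have hji : j ≠ i := fun h => hi (h ▸ hj)
        simp [hji]
      rw [this]
      ring

end TaylorBound

lemma convPow_scalarFam {d : ℕ} (α : ℂ) (m : ℕ) :
    convPow (scalarFam d α) m = scalarFam d (α ^ m) := by
  induction m with
  | zero => simp [convPow, scalarFam, convOne, funext_iff]
  | succ m ih => rw [convPow, ih, conv_scalarFam_left, ← scalarFam_mul_eq_smul, pow_succ']

lemma convProd_constFam {d : ℕ} (a : Fin d → ℝ) (k : Fin d → ℕ) :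
    convProd (constFam a) k = scalarFam d (∏ i, (a i : ℂ) ^ k i) := by
  have h (l : List (Fin d)) :
      (l.map fun i => convPow (constFam a i) (k i)).foldr conv (convOne d) =
        scalarFam d (l.map fun i => (a i : ℂ) ^ k i).prod := by
    induction l with
    | nil => rfl
    | cons i l ih =>
      rw [List.map_cons, List.foldr_cons, ih, List.map_cons, List.prod_cons,
        scalarFam_mul_eq_smul, ← conv_scalarFam_left, ← convPow_scalarFam]
      rfl
  rw [convProd, h, Fin.prod_univ_def]

/-- Second-order Taylor estimate for the monomial `Φ(w) = w^k` in analytic norms: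
`‖(ã+f)^k − ã^k − Σ_{i : k_i ≥ 1} k_i ã^{k−𝟙_i} * f_i‖_δ
   ≤ |f|_δ² · |k|(|k|−1) · (|a|_∞ + |f|_δ)^{|k|−2}`. -/
theorem stmt_13 (d : ℕ) (δ : ℝ) (hδ : 0 ≤ δ) (a : Fin d → ℝ) (k : Fin d → ℕ)
    (f : Fin d → (Fin d → ℤ) → ℂ) (hf : ∀ i, anorm δ (f i) ≠ ⊤) :
    anorm δ (fun n =>
        convProd (fun i => constFam a i + f i) k n
          - convProd (constFam a) k n
          - ∑ i ∈ Finset.univ.filter (fun i => 1 ≤ k i),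
              (k i : ℂ) * conv (convProd (constFam a)
                  (fun j => k j - (if j = i then 1 else 0))) (f i) n)
      ≤ (⨆ i, anorm δ (f i)) ^ 2
          * ((∑ i, k i : ℕ) : ℝ≥0∞) * (((∑ i, k i) - 1 : ℕ) : ℝ≥0∞)
          * ((⨆ i, (‖a i‖₊ : ℝ≥0∞)) + ⨆ i, anorm δ (f i)) ^ ((∑ i, k i) - 2) := by
  set s : ℝ≥0∞ := ⨆ i, anorm δ (f i)
  set A : ℝ≥0∞ := ⨆ i, (‖a i‖₊ : ℝ≥0∞)
  have hs : s ≠ ⊤ := _root_.iSup_ne_top hf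
  have hA : A ≠ ⊤ := _root_.iSup_ne_top fun _ => ENNReal.coe_ne_top
  have hu (i : Fin d) : TaylorBound δ s (A + s) 1 (constFam a i + f i) (a i : ℂ) (f i) := by
    refine TaylorBound.scalar_add ?_ (le_iSup (fun i => anorm δ (f i)) i)
    rw [Complex.nnnorm_real]
    gcongr
    exact le_iSup (fun i => (‖a i‖₊ : ℝ≥0∞)) i
  have h := (TaylorBound.foldr_conv hδ hs (ENNReal.add_ne_top.mpr ⟨hA, hs⟩) hu k
    (List.finRange d) (List.nodup_finRange d)).remainder
  simp only [← Fin.sum_univ_def, ← Fin.prod_univ_def] at h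
  refine le_of_eq_of_le ?_ h
  congr 1
  ext n
  rw [convProd_constFam, Finset.sum_filter]
  simp only [convProd_constFam, conv_scalarFam_left, Pi.sub_apply, Finset.sum_apply,
    Pi.smul_apply, smul_eq_mul]
  congr 1
  refine Finset.sum_congr rfl fun i _ => ?_
  split_ifs with hi
  · ring
  · simp [show k i = 0 by omega]
end
end
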